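/- arXiv:2005.03858 — 2 statements merged into one kernel-verified Lean document; each statement's English description precedes it below -/
import Mathlib

section
/- There exists an absolute constant C > 0 such that the following holds. Let Z ∼ N(0, I_n) be a standard Gaussian vector in ℝⁿ, let R ∈ ℝ^{n×n} be a fixed (deterministic) matrix of rank at most m, and let η ∈ (0, e⁻¹) with log(η⁻¹) ≤ m. Then with probability at least 1 − η, |(n·m)⁻¹ Zᵀ R Z − 1| ≤ (C/n) · ‖R‖_op · √(log(η⁻¹)/m) + |(n·m)⁻¹ tr(R) − 1|, where ‖·‖_op is the operator norm and tr is the trace. -/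
open MeasureTheory ProbabilityTheory Matrix Real

noncomputable section

def stdGaussianPi (n : ℕ) : Measure (Fin n → ℝ) :=
  Measure.pi fun _ => (gaussianReal 0 1 : Measure ℝ)

instance (n : ℕ) : IsProbabilityMeasure (stdGaussianPi n) := by
  unfold stdGaussianPi; infer_instance

def opNorm {q p : ℕ} (A : Matrix (Fin q) (Fin p) ℝ) : ℝ :=
  ‖LinearMap.toContinuousLinearMap (Matrix.toEuclideanLin A)‖

lemma sqrt_inv_one_sub_two_mul_exp_neg_le {s : ℝ} (hs : |s| ≤ 1 / 4) :
    √(1 / (1 - 2 * s)) * exp (-s) ≤ exp (4 * s ^ 2) := by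
  have h2 : |2 * s| ≤ 1 / 2 := by rw [abs_mul]; norm_num; linarith
  have hpos : 0 < 1 - 2 * s := by linarith [le_abs_self (2 * s)]
  have hlog := abs_log_sub_add_sum_range_le (x := 2 * s) (by linarith) 1
  simp only [Finset.sum_range_one, zero_add, pow_one, Nat.cast_zero, div_one] at hlog
  have hb : |2 * s| ^ (1 + 1) / (1 - |2 * s|) ≤ 2 * (2 * s) ^ 2 := by
    rw [div_le_iff₀ (by linarith), show (1 + 1 : ℕ) = 2 from rfl, sq_abs]
    nlinarith [sq_nonneg (2 * s)]
  have hl := (abs_le.mp (hlog.trans hb)).1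
  have hsqrt : √(1 / (1 - 2 * s)) = exp (-log (1 - 2 * s) / 2) := by
    rw [sqrt_eq_rpow, rpow_def_of_pos (by positivity), one_div, log_inv]
    ring_nf
  rw [hsqrt, ← exp_add]
  gcongr
  linarith

lemma gaussianPDFReal_smul_exp_sq (s x : ℝ) :
    gaussianPDFReal 0 1 x • exp (s * (x ^ 2 - 1)) =
      ((√(2 * π))⁻¹ * exp (-s)) * exp (-(1 / 2 - s) * x ^ 2) := by
  simp only [gaussianPDFReal, NNReal.coe_one, smul_eq_mul, mul_one, sub_zero, mul_assoc, ← exp_add]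
  ring_nf

lemma integrable_exp_centered_sq_gaussianReal {s : ℝ} (hs : s < 1 / 2) :
    Integrable (fun x ↦ exp (s * (x ^ 2 - 1))) (gaussianReal 0 1) := by
  rw [gaussianReal_of_var_ne_zero _ one_ne_zero,
    integrable_withDensity_iff_integrable_smul' (by fun_prop)
      (ae_of_all _ fun _ ↦ gaussianPDF_lt_top)]
  simp only [toReal_gaussianPDF, gaussianPDFReal_smul_exp_sq]
  exact (integrable_exp_neg_mul_sq (by linarith)).const_mul _

lemma integral_exp_centered_sq_gaussianReal_le {s : ℝ} (hs : |s| ≤ 1 / 4) :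
    ∫ x, exp (s * (x ^ 2 - 1)) ∂(gaussianReal 0 1) ≤ exp (4 * s ^ 2) := by
  have hpos : 0 < 1 - 2 * s := by linarith [le_abs_self s]
  refine le_trans (le_of_eq ?_) (sqrt_inv_one_sub_two_mul_exp_neg_le hs)
  rw [integral_gaussianReal_eq_integral_smul one_ne_zero]
  simp only [gaussianPDFReal_smul_exp_sq]
  rw [integral_const_mul, integral_gaussian, mul_right_comm, ← sqrt_inv, ← sqrt_mul (by positivity)]
  congr 2
  have : (1 / 2 - s) ≠ 0 := by linarith
  field_simp

lemma measureReal_weighted_chiSq_ge_le {ι : Type*} [Fintype ι] (w : ι → ℝ) {t : ℝ} (ht : 0 ≤ t)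
    (hw : ∀ i, |t * w i| ≤ 1 / 4) (ε : ℝ) :
    (Measure.pi fun _ : ι ↦ gaussianReal 0 1).real {x | ε ≤ ∑ i, w i * (x i ^ 2 - 1)} ≤
      exp (-t * ε + ∑ i, 4 * (t * w i) ^ 2) := by
  have hprod : (fun x : ι → ℝ ↦ exp (t * ∑ i, w i * (x i ^ 2 - 1))) =
      fun x ↦ ∏ i, exp (t * w i * (x i ^ 2 - 1)) := by
    ext x
    rw [← exp_sum, Finset.mul_sum]
    simp only [mul_assoc]
  rw [exp_add, exp_sum]
  refine (measure_ge_le_exp_mul_mgf ε ht ?_).trans ?_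
  · rw [hprod]
    exact Integrable.fintype_prod fun i ↦ integrable_exp_centered_sq_gaussianReal
      (by linarith [le_abs_self (t * w i), hw i])
  · rw [mgf, hprod, integral_fintype_prod_eq_prod (f := fun i y ↦ exp (t * w i * (y ^ 2 - 1)))]
    gcongr with i
    exact integral_exp_centered_sq_gaussianReal_le (hw i)

/-- Rotation invariance: a quadratic form in a standard Gaussian vector has the law of a
weighted sum of independent squares, the weights being the eigenvalues. -/
lemma map_quadraticForm_pi_gaussianReal {ι : Type*} [Fintype ι] [DecidableEq ι]
    {A : Matrix ι ι ℝ} (hA : A.IsHermitian) :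
    (Measure.pi fun _ : ι ↦ gaussianReal 0 1).map (fun z ↦ z ⬝ᵥ A *ᵥ z) =
      (Measure.pi fun _ : ι ↦ gaussianReal 0 1).map (fun x ↦ ∑ i, hA.eigenvalues i * x i ^ 2) := by
  have hmeas : Measurable fun z : ι → ℝ ↦ z ⬝ᵥ A *ᵥ z := by
    simp only [dotProduct, mulVec]; fun_prop
  have hmeas' : Measurable fun v : EuclideanSpace ℝ ι ↦ v.ofLp ⬝ᵥ A *ᵥ v.ofLp :=
    hmeas.comp (by fun_prop)
  have h := (map_pi_eq_stdGaussian (ι := ι)).trans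
    (stdGaussian_eq_map_pi_orthonormalBasis hA.eigenvectorBasis)
  have h' := congrArg (Measure.map fun v : EuclideanSpace ℝ ι ↦ v.ofLp ⬝ᵥ A *ᵥ v.ofLp) h
  rw [Measure.map_map hmeas' (by fun_prop), Measure.map_map hmeas' (by fun_prop)] at h'
  refine h'.trans (congrArg (fun f ↦ Measure.map f _) ?_)
  ext x
  have hT : A *ᵥ (∑ i, x i • hA.eigenvectorBasis i : EuclideanSpace ℝ ι).ofLp =
      (∑ i, (x i * hA.eigenvalues i) • hA.eigenvectorBasis i : EuclideanSpace ℝ ι).ofLp := by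
    simp only [WithLp.ofLp_sum, WithLp.ofLp_smul, mulVec_sum, mulVec_smul,
      hA.mulVec_eigenvectorBasis, smul_smul]
  have hinner := hA.eigenvectorBasis.orthonormal.inner_sum (fun i ↦ x i * hA.eigenvalues i) x
    Finset.univ
  rw [EuclideanSpace.inner_eq_star_dotProduct] at hinner
  simp only [Function.comp_apply, hT]
  refine (Eq.trans (by simp) hinner).trans (Finset.sum_congr rfl fun i _ ↦ ?_)
  simp
  ring

lemma abs_dotProduct_mulVec_le_opNorm {n : ℕ} (R : Matrix (Fin n) (Fin n) ℝ)
    (v : EuclideanSpace ℝ (Fin n)) :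
    |v.ofLp ⬝ᵥ R *ᵥ v.ofLp| ≤ opNorm R * ‖v‖ ^ 2 := by
  have h : v.ofLp ⬝ᵥ R *ᵥ v.ofLp =
      inner ℝ (LinearMap.toContinuousLinearMap (Matrix.toEuclideanLin R) v) v := by
    rw [EuclideanSpace.inner_eq_star_dotProduct]
    simp [Matrix.toLpLin_apply]
  rw [h]
  refine (abs_real_inner_le_norm _ _).trans ?_
  rw [sq, ← mul_assoc]
  gcongr
  exact ContinuousLinearMap.le_opNorm _ _

lemma dotProduct_add_transpose_mulVec {ι : Type*} [Fintype ι] (R : Matrix ι ι ℝ) (z : ι → ℝ) :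
    z ⬝ᵥ (R + Rᵀ) *ᵥ z = 2 * (z ⬝ᵥ R *ᵥ z) := by
  rw [add_mulVec, dotProduct_add, mulVec_transpose, dotProduct_comm z (z ᵥ* R),
    ← dotProduct_mulVec, two_mul]

lemma abs_eigenvalues_add_transpose_le {n : ℕ} (R : Matrix (Fin n) (Fin n) ℝ)
    (hA : (R + Rᵀ).IsHermitian) (i : Fin n) : |hA.eigenvalues i| ≤ 2 * opNorm R := by
  set v := hA.eigenvectorBasis i
  have h1 : hA.eigenvalues i = 2 * (v.ofLp ⬝ᵥ R *ᵥ v.ofLp) := by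
    rw [← dotProduct_add_transpose_mulVec, hA.eigenvalues_eq]
    simp [v]
  have h2 := abs_dotProduct_mulVec_le_opNorm R v
  rw [h1, abs_mul, abs_two]
  simpa [v] using h2

lemma rank_add_transpose_le {ι : Type*} [Fintype ι] (R : Matrix ι ι ℝ) :
    (R + Rᵀ).rank ≤ 2 * R.rank := by
  have h := (Submodule.finrank_mono (LinearMap.range_add_le R.mulVecLin Rᵀ.mulVecLin)).trans
    (Submodule.finrank_add_le_finrank_add_finrank _ _)
  rw [← mulVecLin_add] at h
  have ht : Rᵀ.rank = R.rank := rank_transpose R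
  simp only [Matrix.rank] at ht ⊢
  omega

/-- Two-sided Hanson-Wright bound for a matrix of rank at most `m`, in the sub-Gaussian range
of deviations. -/
lemma measureReal_quadraticForm_sub_trace_gt_le {n m : ℕ} {R : Matrix (Fin n) (Fin n) ℝ}
    (hR : R.rank ≤ m) (hK : 0 < opNorm R) {L : ℝ} (hL : 0 < L) (hLm : L ≤ m) :
    (stdGaussianPi n).real {z | 10 * opNorm R * √(m * L) < |z ⬝ᵥ R *ᵥ z - R.trace|} ≤
      2 * exp (-2 * L) := by
  have hm : (0 : ℝ) < m := hL.trans_le hLm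
  have hA : (R + Rᵀ).IsHermitian := by
    rw [IsHermitian, conjTranspose_eq_transpose_of_trivial, transpose_add, transpose_transpose,
      add_comm]
  set K := opNorm R
  set ε := 10 * K * √(m * L)
  set w : Fin n → ℝ := fun i ↦ hA.eigenvalues i / 2 with hw_def
  have hw (i) : |w i| ≤ K := by
    rw [hw_def, abs_div, abs_two]
    linarith [abs_eigenvalues_add_transpose_le R hA i]
  have htr : R.trace = ∑ i, w i := by
    have h := hA.trace_eq_sum_eigenvalues
    rw [trace_add, trace_transpose] at h
    simp only [hw_def, ← Finset.sum_div]
    simp only [RCLike.ofReal_real_eq_id, id] at h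
    linarith
  set t := √(L / m) / 4 / K
  have ht : 0 ≤ t := by positivity
  have htK : t * K = √(L / m) / 4 := div_mul_cancel₀ _ hK.ne'
  have htw (i) : |t * w i| ≤ √(L / m) / 4 := by
    rw [abs_mul, abs_of_nonneg ht, ← htK]
    gcongr
    exact hw i
  have hsqrt : √(L / m) ≤ 1 :=
    sqrt_le_iff.mpr ⟨zero_le_one, by rwa [one_pow, div_le_one hm]⟩
  have hcard : (Finset.univ.filter fun i ↦ hA.eigenvalues i ≠ 0).card ≤ 2 * m := by
    rw [← Fintype.card_subtype, ← hA.rank_eq_card_non_zero_eigs]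
    exact (rank_add_transpose_le R).trans (by omega)
  have hsum : ∑ i, 4 * (t * w i) ^ 2 ≤ L / 2 := by
    calc ∑ i, 4 * (t * w i) ^ 2
        = ∑ i with hA.eigenvalues i ≠ 0, 4 * (t * w i) ^ 2 := by
          refine (Finset.sum_filter_of_ne fun i _ hi ↦ mt (fun h0 ↦ ?_) hi).symm
          simp [hw_def, h0]
      _ ≤ (Finset.univ.filter fun i ↦ hA.eigenvalues i ≠ 0).card • (L / m / 4) := by
          refine Finset.sum_le_card_nsmul _ _ _ fun i _ ↦ ?_
          have h := pow_le_pow_left₀ (abs_nonneg _) (htw i) 2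
          rw [sq_abs, div_pow, sq_sqrt (by positivity)] at h
          linarith
      _ ≤ (2 * m : ℝ) * (L / m / 4) := by
          rw [nsmul_eq_mul]
          gcongr
          exact_mod_cast hcard
      _ = L / 2 := by field_simp; ring
  have htε : t * ε = 5 / 2 * L := by
    have h : √(L / m) * √(m * L) = L := by
      rw [← sqrt_mul (by positivity), show L / m * (m * L) = L ^ 2 by field_simp, sqrt_sq hL.le]
    calc t * ε = 10 * (t * K) * √(m * L) := by ring
      _ = 5 / 2 * (√(L / m) * √(m * L)) := by rw [htK]; ring
      _ = 5 / 2 * L := by rw [h]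
  have htail (w' : Fin n → ℝ) (hw' : ∀ i, |t * w' i| = |t * w i|) :
      (stdGaussianPi n).real {x | ε ≤ ∑ i, w' i * (x i ^ 2 - 1)} ≤ exp (-2 * L) := by
    refine (measureReal_weighted_chiSq_ge_le w' ht
      (fun i ↦ (hw' i).trans_le ((htw i).trans (by linarith))) ε).trans ?_
    have h : ∑ i, 4 * (t * w' i) ^ 2 = ∑ i, 4 * (t * w i) ^ 2 :=
      Finset.sum_congr rfl fun i _ ↦ by rw [← sq_abs, hw' i, sq_abs]
    rw [h]
    gcongr
    linarith
  have hlaw : (stdGaussianPi n).real {z | ε < |z ⬝ᵥ R *ᵥ z - R.trace|} =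
      (stdGaussianPi n).real {x | ε < |∑ i, w i * (x i ^ 2 - 1)|} := by
    have hS : MeasurableSet {y : ℝ | ε < |y / 2 - R.trace|} :=
      measurableSet_lt measurable_const (by fun_prop)
    have h := congrArg (fun μ ↦ μ.real {y : ℝ | ε < |y / 2 - R.trace|})
      (map_quadraticForm_pi_gaussianReal hA)
    simp only at h
    rw [map_measureReal_apply (by simp only [dotProduct, mulVec]; fun_prop) hS,
      map_measureReal_apply (by fun_prop) hS] at h
    convert! h using 2
    · ext z
      simp [dotProduct_add_transpose_mulVec]
    · ext x
      simp only [Set.mem_ofPred_eq, Set.mem_preimage, htr, hw_def, Finset.sum_div,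
        ← Finset.sum_sub_distrib]
      ring_nf
  rw [hlaw]
  calc (stdGaussianPi n).real {x | ε < |∑ i, w i * (x i ^ 2 - 1)|}
      ≤ (stdGaussianPi n).real ({x | ε ≤ ∑ i, w i * (x i ^ 2 - 1)} ∪
          {x | ε ≤ ∑ i, -w i * (x i ^ 2 - 1)}) := by
        refine measureReal_mono fun x hx ↦ ?_
        simp only [Set.mem_union, Set.mem_ofPred_eq, neg_mul, Finset.sum_neg_distrib] at hx ⊢
        exact (lt_abs.mp hx).imp le_of_lt le_of_lt
    _ ≤ exp (-2 * L) + exp (-2 * L) :=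
        (measureReal_union_le _ _).trans
          (add_le_add (htail w fun _ ↦ rfl) (htail (fun i ↦ -w i) fun i ↦ by simp))
    _ = 2 * exp (-2 * L) := by ring

lemma eq_zero_of_opNorm_eq_zero {n : ℕ} {R : Matrix (Fin n) (Fin n) ℝ} (h : opNorm R = 0) :
    R = 0 := by
  simpa [opNorm] using h

/-- Lemma 4 (conditional Hanson-Wright type bound). -/
theorem conditional_hanson_wright :
    ∃ C : ℝ, 0 < C ∧
      ∀ (n m : ℕ) (R : Matrix (Fin n) (Fin n) ℝ) (η : ℝ),
        R.rank ≤ m →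
        0 < η → η < Real.exp (-1) →
        Real.log η⁻¹ ≤ (m : ℝ) →
        ENNReal.ofReal (1 - η) ≤
          stdGaussianPi n
            {z |
              |((n : ℝ) * m)⁻¹ * (z ⬝ᵥ R.mulVec z) - 1| ≤
                C / n * opNorm R * Real.sqrt (Real.log η⁻¹ / m) +
                  |((n : ℝ) * m)⁻¹ * R.trace - 1|} := by
  refine ⟨10, by norm_num, fun n m R η hR hη hη' hLm ↦ ?_⟩
  set L := Real.log η⁻¹ with hL_def
  have hL : 1 < L := by
    rw [hL_def, log_inv]
    linarith [(log_lt_iff_lt_exp hη).mpr hη']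
  have hexp : exp (-L) = η := by rw [hL_def, log_inv, neg_neg, exp_log hη]
  have hm : (0 : ℝ) < m := by linarith
  rcases (show 0 ≤ opNorm R from norm_nonneg _).eq_or_lt' with hK | hK
  · obtain rfl := eq_zero_of_opNorm_eq_zero hK
    simp [hK, hη.le]
  rcases Nat.eq_zero_or_pos n with rfl | hn
  · simp [hη.le]
  have hn : (0 : ℝ) < n := by exact_mod_cast hn
  have hmeas : MeasurableSet {z : Fin n → ℝ |
      10 * opNorm R * √(m * L) < |z ⬝ᵥ R *ᵥ z - R.trace|} := by
    refine measurableSet_lt measurable_const ?_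
    simp only [dotProduct, mulVec]
    fun_prop
  have htail := measureReal_quadraticForm_sub_trace_gt_le hR hK (by linarith) hLm
  have hη2 : 2 * exp (-2 * L) ≤ η := by
    have h2 : 2 * exp (-L) ≤ 1 := by
      rw [Real.exp_neg, ← div_eq_mul_inv, div_le_one (exp_pos _)]
      linarith [add_one_le_exp L]
    rw [show -2 * L = -L + -L by ring, exp_add, ← hexp]
    nlinarith [exp_pos (-L)]
  have hcompl := probReal_compl_eq_one_sub (μ := stdGaussianPi n) hmeas
  refine (ENNReal.ofReal_le_ofReal
    (show 1 - η ≤ (stdGaussianPi n).real _ by rw [hcompl]; linarith)).trans ?_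
  rw [ofReal_measureReal]
  refine measure_mono fun z hz ↦ ?_
  simp only [Set.mem_compl_iff, Set.mem_ofPred_eq, not_lt] at hz ⊢
  have hsqrt : √(m * L) = m * √(L / m) := by
    rw [show (m : ℝ) * L = m ^ 2 * (L / m) by field_simp, sqrt_mul (by positivity),
      sqrt_sq hm.le]
  calc |((n : ℝ) * m)⁻¹ * (z ⬝ᵥ R *ᵥ z) - 1|
      = |((n : ℝ) * m)⁻¹ * (z ⬝ᵥ R *ᵥ z - R.trace) + (((n : ℝ) * m)⁻¹ * R.trace - 1)| := by
        ring_nf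
    _ ≤ ((n : ℝ) * m)⁻¹ * |z ⬝ᵥ R *ᵥ z - R.trace| + |((n : ℝ) * m)⁻¹ * R.trace - 1| := by
        refine (abs_add_le _ _).trans_eq ?_
        rw [abs_mul, abs_of_nonneg (by positivity : 0 ≤ ((n : ℝ) * m)⁻¹)]
    _ ≤ ((n : ℝ) * m)⁻¹ * (10 * opNorm R * √(m * L)) + |((n : ℝ) * m)⁻¹ * R.trace - 1| := by
        gcongr
    _ = 10 / n * opNorm R * √(L / m) + |((n : ℝ) * m)⁻¹ * R.trace - 1| := by
        rw [hsqrt]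
        field_simp
end
end

section
/- Let s ∈ (0,1) and let X be a random variable with P(X = 0) = 1 − s and P(X = 1) = P(X = −1) = s/2. Then the sub-Gaussian norm of X equals {log(1 + s⁻¹)}^{−1/2}, and the sub-Gaussian norm of X/√s equals K_s = {s · log(1 + s⁻¹)}^{−1/2}. -/
open MeasureTheory ProbabilityTheory Real

noncomputable section

/-- The sub-Gaussian norm `‖Z‖_{ψ₂} = inf {t > 0 : E exp(Z²/t²) ≤ 2}`. -/
def subGaussianNorm {Ω : Type*} [MeasurableSpace Ω] (μ : Measure Ω) (X : Ω → ℝ) : ℝ :=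
  sInf {t : ℝ | 0 < t ∧ ∫ ω, Real.exp ((X ω) ^ 2 / t ^ 2) ∂μ ≤ 2}

/-- A variable with values in `{0, 1, -1}` almost surely has `E exp(c X²) = 1 + s (exp c - 1)`,
where `s` is the probability that it does not vanish. -/
theorem integral_exp_mul_sq_of_ae_sign {Ω : Type*} [MeasurableSpace Ω] (μ : Measure Ω)
    [IsProbabilityMeasure μ] {X : Ω → ℝ} (hX : Measurable X)
    (hae : ∀ᵐ ω ∂μ, X ω = 0 ∨ X ω = 1 ∨ X ω = -1) (c : ℝ) :
    ∫ ω, Real.exp (c * X ω ^ 2) ∂μ = 1 + (1 - μ.real {ω | X ω = 0}) * (Real.exp c - 1) := by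
  have hA : MeasurableSet {ω | X ω = 0} := hX (measurableSet_singleton 0)
  have hcongr : (fun ω => Real.exp (c * X ω ^ 2)) =ᵐ[μ]
      fun ω => 1 + {ω | X ω = 0}ᶜ.indicator (fun _ => Real.exp c - 1) ω := by
    filter_upwards [hae] with ω hω
    rcases hω with h | h | h <;> simp [Set.indicator, h]
  rw [integral_congr_ae hcongr, integral_add (integrable_const _)
    ((integrable_const _).indicator hA.compl), integral_indicator_const _ hA.compl,
    probReal_compl_eq_one_sub hA]
  simp

theorem ae_sign_of_sparse_rademacher {Ω : Type*} [MeasurableSpace Ω] (μ : Measure Ω)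
    [IsProbabilityMeasure μ] {X : Ω → ℝ} (hX : Measurable X) {s : ℝ} (hs0 : 0 ≤ s) (hs1 : s ≤ 1)
    (h0 : μ {ω | X ω = 0} = ENNReal.ofReal (1 - s))
    (h1 : μ {ω | X ω = 1} = ENNReal.ofReal (s / 2))
    (hm1 : μ {ω | X ω = -1} = ENNReal.ofReal (s / 2)) :
    ∀ᵐ ω ∂μ, X ω = 0 ∨ X ω = 1 ∨ X ω = -1 := by
  have hmeas (a : ℝ) : MeasurableSet {ω | X ω = a} := hX (measurableSet_singleton a)
  have hset : {ω | X ω = 0 ∨ X ω = 1 ∨ X ω = -1} =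
      {ω | X ω = 0} ∪ ({ω | X ω = 1} ∪ {ω | X ω = -1}) := rfl
  have hmeasure : μ {ω | X ω = 0 ∨ X ω = 1 ∨ X ω = -1} = 1 := by
    rw [hset, measure_union _ ((hmeas 1).union (hmeas (-1))), measure_union _ (hmeas (-1)),
      h0, h1, hm1, ← ENNReal.ofReal_add (by linarith) (by linarith),
      ← ENNReal.ofReal_add (by linarith) (by linarith)]
    · ring_nf
      simp
    · rw [Set.disjoint_left]
      intro ω h h'
      simp only [Set.mem_ofPred_eq] at h h'
      linarith
    · rw [Set.disjoint_left]
      rintro ω h (h' | h') <;> simp only [Set.mem_ofPred_eq] at h h' <;> linarith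
  exact (mem_ae_iff_prob_eq_one (hset ▸ (hmeas 0).union ((hmeas 1).union (hmeas (-1))))).2 hmeasure

theorem subGaussianNorm_div_of_sparse_rademacher {Ω : Type*} [MeasurableSpace Ω] (μ : Measure Ω)
    [IsProbabilityMeasure μ] {X : Ω → ℝ} (hX : Measurable X) {s : ℝ} (hs0 : 0 < s) (hs1 : s ≤ 1)
    (h0 : μ {ω | X ω = 0} = ENNReal.ofReal (1 - s))
    (h1 : μ {ω | X ω = 1} = ENNReal.ofReal (s / 2))
    (hm1 : μ {ω | X ω = -1} = ENNReal.ofReal (s / 2)) {r : ℝ} (hr : 0 < r) :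
    subGaussianNorm μ (fun ω => X ω / r) = (Real.sqrt (r ^ 2 * Real.log (1 + s⁻¹)))⁻¹ := by
  have hinv : 0 < s⁻¹ := inv_pos.2 hs0
  have hL : 0 < Real.log (1 + s⁻¹) := Real.log_pos (by linarith)
  have hK : 0 < Real.sqrt (r ^ 2 * Real.log (1 + s⁻¹)) := by positivity
  have hreal : μ.real {ω | X ω = 0} = 1 - s := by
    rw [measureReal_def, h0, ENNReal.toReal_ofReal (by linarith)]
  have hint (t : ℝ) : ∫ ω, Real.exp ((X ω / r) ^ 2 / t ^ 2) ∂μ =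
      1 + s * (Real.exp ((r ^ 2 * t ^ 2)⁻¹) - 1) := by
    have h := integral_exp_mul_sq_of_ae_sign μ hX
      (ae_sign_of_sparse_rademacher μ hX hs0.le hs1 h0 h1 hm1) (r ^ 2 * t ^ 2)⁻¹
    rw [hreal, sub_sub_cancel] at h
    rw [← h]
    congr with ω
    rw [div_pow, div_div, div_eq_inv_mul]
  have hset : {t : ℝ | 0 < t ∧ ∫ ω, Real.exp ((X ω / r) ^ 2 / t ^ 2) ∂μ ≤ 2} =
      Set.Ici (Real.sqrt (r ^ 2 * Real.log (1 + s⁻¹)))⁻¹ := by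
    ext t
    rw [Set.mem_ofPred_eq, hint, Set.mem_Ici]
    have key (ht : 0 < t) : 1 + s * (Real.exp ((r ^ 2 * t ^ 2)⁻¹) - 1) ≤ 2 ↔
        (Real.sqrt (r ^ 2 * Real.log (1 + s⁻¹)))⁻¹ ≤ t := by
      calc 1 + s * (Real.exp ((r ^ 2 * t ^ 2)⁻¹) - 1) ≤ 2
          ↔ s * (Real.exp ((r ^ 2 * t ^ 2)⁻¹) - 1) ≤ 1 := by
            constructor <;> intro h <;> linarith
        _ ↔ Real.exp ((r ^ 2 * t ^ 2)⁻¹) ≤ 1 + s⁻¹ := by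
            rw [← le_div_iff₀' hs0, one_div, sub_le_iff_le_add']
        _ ↔ (r ^ 2 * t ^ 2)⁻¹ ≤ Real.log (1 + s⁻¹) :=
            (Real.le_log_iff_exp_le (by linarith)).symm
        _ ↔ t⁻¹ ^ 2 ≤ r ^ 2 * Real.log (1 + s⁻¹) := by
            rw [mul_inv, inv_mul_le_iff₀ (by positivity), inv_pow]
        _ ↔ t⁻¹ ≤ Real.sqrt (r ^ 2 * Real.log (1 + s⁻¹)) :=
            (Real.le_sqrt' (by positivity)).symm
        _ ↔ (Real.sqrt (r ^ 2 * Real.log (1 + s⁻¹)))⁻¹ ≤ t := inv_le_comm₀ ht hK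
    exact ⟨fun h => (key h.1).1 h.2, fun h =>
      have ht := (inv_pos.2 hK).trans_le h
      ⟨ht, (key ht).2 h⟩⟩
  rw [subGaussianNorm, hset, csInf_Ici]

/-- Lemma 5 (sub-Gaussian norms of a sparse Rademacher variable). -/
theorem sparse_rademacher_subGaussian_norm
    {Ω : Type*} [MeasurableSpace Ω] (μ : Measure Ω) [IsProbabilityMeasure μ]
    (X : Ω → ℝ) (hX : Measurable X) (s : ℝ) (hs0 : 0 < s) (hs1 : s < 1)
    (h0 : μ {ω | X ω = 0} = ENNReal.ofReal (1 - s))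
    (h1 : μ {ω | X ω = 1} = ENNReal.ofReal (s / 2))
    (hm1 : μ {ω | X ω = -1} = ENNReal.ofReal (s / 2)) :
    subGaussianNorm μ X = (Real.sqrt (Real.log (1 + s⁻¹)))⁻¹ ∧
      subGaussianNorm μ (fun ω => X ω / Real.sqrt s) =
        (Real.sqrt (s * Real.log (1 + s⁻¹)))⁻¹ := by
  have h := fun {r : ℝ} (hr : 0 < r) =>
    subGaussianNorm_div_of_sparse_rademacher μ hX hs0 hs1.le h0 h1 hm1 hr
  refine ⟨by simpa using h one_pos, ?_⟩
  rw [h (Real.sqrt_pos.2 hs0), Real.sq_sqrt hs0.le]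
end
end
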